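/- arXiv:1710.09336 — 2 statements merged into one kernel-verified Lean document; each statement's English description precedes it below -/
import Mathlib

section
/- Let μ be an ergodic structure. Then there is no first-order formula φ(x̄, y), with x̄ = (x₁,…,xₙ), such that μ(⟦∃x̄ ∃!y ((⋀_{i=1}^n y ≠ xᵢ) ∧ φ(x̄, y))⟧) = 1. That is, the almost-sure first-order theory Th_FO(μ) = {φ a first-order sentence : μ(⟦φ⟧) = 1} has trivial definable closure. -/
open FirstOrder Language MeasureTheory Set
open scoped ENNReal

namespace Ergo


/-- The space of L-structures with domain ℕ. -/
abbrev StrL (L : FirstOrder.Language.{0,0}) : Type :=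
  ∀ n : ℕ, L.Relations n → (Fin n → ℕ) → Bool

variable (L : FirstOrder.Language.{0,0})

/-- The L-structure on ℕ coded by a point of `StrL L`. -/
def toStructure [L.IsRelational] (x : StrL L) : L.Structure ℕ where
  funMap := fun f _ => isEmptyElim f
  RelMap := fun {n} r a => x n r a = true

/-- The logic action of a permutation of ℕ on `StrL L`. -/
def act (σ : Equiv.Perm ℕ) (x : StrL L) : StrL L :=
  fun n r a => x n r (fun i => σ.symm (a i))

/-- Satisfaction of a sentence at a point of `StrL L`. -/
def SatS [L.IsRelational] (x : StrL L) (φ : L.Sentence) : Prop :=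
  letI := toStructure L x
  Sentence.Realize ℕ φ

/-- Satisfaction of a formula at a point of `StrL L` under an assignment. -/
def SatF [L.IsRelational] (x : StrL L) {n : ℕ} (φ : L.Formula (Fin n)) (a : Fin n → ℕ) : Prop :=
  letI := toStructure L x
  Formula.Realize φ a

/-- `⟦φ⟧`, the set of structures satisfying the sentence φ. -/
def extS [L.IsRelational] (φ : L.Sentence) : Set (StrL L) := {x | SatS L x φ}

/-- `⟦φ(ā)⟧`, the set of structures satisfying φ(ā). -/
def extF [L.IsRelational] {n : ℕ} (φ : L.Formula (Fin n)) (a : Fin n → ℕ) : Set (StrL L) :=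
  {x | SatF L x φ a}

/-- Invariance of a measure under the logic action. -/
def Invariant (μ : Measure (StrL L)) : Prop :=
  ∀ (σ : Equiv.Perm ℕ) (X : Set (StrL L)), MeasurableSet X → μ (act L σ '' X) = μ X

/-- An ergodic structure: an ergodic invariant Borel probability measure on `StrL L`. -/
def IsErgodicStructure (μ : Measure (StrL L)) : Prop :=
  IsProbabilityMeasure μ ∧ Invariant L μ ∧
    ∀ X : Set (StrL L), MeasurableSet X →
      (∀ σ : Equiv.Perm ℕ, μ (symmDiff X (act L σ '' X)) = 0) → μ X = 0 ∨ μ X = 1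

/-- The isomorphism class (orbit of the logic action) of a point of `StrL L`. -/
def IsoClass (M : StrL L) : Set (StrL L) := {N | ∃ σ : Equiv.Perm ℕ, act L σ M = N}

/-- All isomorphism classes are null: the defining property of proper ergodicity. -/
def OrbitsNull (μ : Measure (StrL L)) : Prop := ∀ M : StrL L, μ (IsoClass L M) = 0

/-- Realization of a formula in an explicitly given structure. -/
def RealizeIn (M : Type) (iM : L.Structure M) {n : ℕ} (φ : L.Formula (Fin n))
    (a : Fin n → M) : Prop :=
  letI := iM
  Formula.Realize φ a

/-- Satisfaction of a sentence in an explicitly given structure. -/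
def SatSIn (M : Type) (iM : L.Structure M) (φ : L.Sentence) : Prop :=
  letI := iM
  Sentence.Realize M φ

/-- A complete first-order n-type: the set of formulas satisfied by a fixed tuple
in some L-structure. -/
def IsCompleteType (n : ℕ) (p : Set (L.Formula (Fin n))) : Prop :=
  ∃ (M : Type) (iM : L.Structure M) (a : Fin n → M), p = {φ | RealizeIn L M iM φ a}

/-- A complete quantifier-free n-type. -/
def IsQfCompleteType (n : ℕ) (p : Set (L.Formula (Fin n))) : Prop :=
  ∃ (M : Type) (iM : L.Structure M) (a : Fin n → M),
    p = {φ | φ.IsQF ∧ RealizeIn L M iM φ a}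

/-- A type is non-redundant if it contains `xᵢ ≠ xⱼ` for all `i ≠ j`. -/
def NonRedundant (n : ℕ) (p : Set (L.Formula (Fin n))) : Prop :=
  ∀ i j : Fin n, i ≠ j → BoundedFormula.not (Term.equal (Term.var i) (Term.var j)) ∈ p

/-- The set of structures in which the canonical distinct tuple (0,…,n−1) realizes p;
`μ` of this set is the measure `μ(p)` of the type `p`. -/
def typeSet [L.IsRelational] {n : ℕ} (p : Set (L.Formula (Fin n))) : Set (StrL L) :=
  {x | ∀ φ ∈ p, SatF L x φ (fun i => (i : ℕ))}

/-- Realization of (all formulas of) a type in an explicit structure by a tuple. -/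
def RealizesTypeIn (M : Type) (iM : L.Structure M) {n : ℕ} (p : Set (L.Formula (Fin n)))
    (a : Fin n → M) : Prop :=
  ∀ φ ∈ p, RealizeIn L M iM φ a

/-- χ-rootedness with respect to quantifier-free types. -/
def ChiRootedQfOn (M : Type) (iM : L.Structure M) {n : ℕ} (χ : L.Formula (Fin n)) : Prop :=
  ∀ p : Set (L.Formula (Fin n)), IsQfCompleteType L n p → NonRedundant L n p → χ ∈ p →
    (∃ a, RealizesTypeIn L M iM p a) →
    ∃ r : M, ∀ a, RealizesTypeIn L M iM p a → ∃ i, a i = r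

/-- χ-rootedness with respect to complete first-order types. -/
def ChiRootedFullOn (M : Type) (iM : L.Structure M) {n : ℕ} (χ : L.Formula (Fin n)) : Prop :=
  ∀ p : Set (L.Formula (Fin n)), IsCompleteType L n p → NonRedundant L n p → χ ∈ p →
    (∃ a, RealizesTypeIn L M iM p a) →
    ∃ r : M, ∀ a, RealizesTypeIn L M iM p a → ∃ i, a i = r

/-- Satisfaction is invariant under the logic action. -/
theorem realize_act [L.IsRelational] (σ : Equiv.Perm ℕ) (x : StrL L) {α : Type} {n : ℕ}
    (φ : L.BoundedFormula α n) (v : α → ℕ) (w : Fin n → ℕ) :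
    @BoundedFormula.Realize L ℕ (toStructure L (act L σ x)) α n φ (σ ∘ v) (σ ∘ w) ↔
      @BoundedFormula.Realize L ℕ (toStructure L x) α n φ v w := by
  have term : ∀ {m : ℕ} (t : L.Term (α ⊕ Fin m)) (u : Fin m → ℕ),
      @Term.realize L ℕ (toStructure L (act L σ x)) _ (Sum.elim (σ ∘ v) (σ ∘ u)) t =
        σ (@Term.realize L ℕ (toStructure L x) _ (Sum.elim v u) t) := by
    intro m t u
    cases t with
    | var i => cases i <;> rfl
    | func f ts => exact isEmptyElim f
  induction φ with
  | falsum => exact Iff.rfl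
  | equal t₁ t₂ =>
    simp only [BoundedFormula.Realize, term, EmbeddingLike.apply_eq_iff_eq]
  | rel R ts =>
    simp only [BoundedFormula.Realize, term]
    change x _ R (fun i => σ.symm (σ _)) = true ↔ x _ R _ = true
    simp only [Equiv.symm_apply_apply]
  | imp φ ψ hφ hψ =>
    simp only [BoundedFormula.Realize, hφ, hψ]
  | all φ hφ =>
    simp only [BoundedFormula.Realize]
    rw [← σ.forall_congr_right]
    refine forall_congr' fun b => ?_
    have h := hφ (Fin.snoc w b)
    rw [Fin.comp_snoc] at h
    exact h

/-- The set of structures satisfying a formula under a fixed assignment is measurable. -/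
theorem measurableSet_realize [L.IsRelational] {α : Type} {n : ℕ}
    (φ : L.BoundedFormula α n) (v : α → ℕ) (w : Fin n → ℕ) :
    MeasurableSet
      {x : StrL L | @BoundedFormula.Realize L ℕ (toStructure L x) α n φ v w} := by
  have term : ∀ {m : ℕ} (t : L.Term (α ⊕ Fin m)) (u : Fin m → ℕ),
      ∃ c, ∀ x, @Term.realize L ℕ (toStructure L x) _ (Sum.elim v u) t = c := by
    intro m t u
    cases t with
    | var i => exact ⟨Sum.elim v u i, fun _ => rfl⟩
    | func f ts => exact isEmptyElim f
  induction φ with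
  | falsum => exact MeasurableSet.empty
  | equal t₁ t₂ =>
    obtain ⟨c₁, h₁⟩ := term t₁ w
    obtain ⟨c₂, h₂⟩ := term t₂ w
    simp only [BoundedFormula.Realize, h₁, h₂, MeasurableSet.const]
  | @rel m k R ts =>
    choose c hc using fun i => term (ts i) w
    simp only [BoundedFormula.Realize, hc]
    have h : Measurable fun x : StrL L => x k R c := by fun_prop
    exact h (measurableSet_singleton true)
  | imp φ ψ hφ hψ =>
    exact (hφ w).imp (hψ w)
  | all φ hφ =>
    simp only [BoundedFormula.Realize]
    rw [ofPred_forall]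
    exact MeasurableSet.iInter fun b => hφ _

theorem measurableSet_extF [L.IsRelational] {n : ℕ} (φ : L.Formula (Fin n)) (a : Fin n → ℕ) :
    MeasurableSet (extF L φ a) :=
  measurableSet_realize L φ a (@default _ Unique.instInhabited)

theorem satF_act [L.IsRelational] (σ : Equiv.Perm ℕ) (x : StrL L) {n : ℕ}
    (φ : L.Formula (Fin n)) (a : Fin n → ℕ) :
    SatF L (act L σ x) φ (σ ∘ a) ↔ SatF L x φ a := by
  let w : Fin 0 → ℕ := @default _ Unique.instInhabited
  have h := realize_act L σ x φ a w
  rw [Subsingleton.elim (σ ∘ w) w] at h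
  exact h

/-- The structures in which `b` is the unique solution of `φ(a, y)` outside the tuple `a`. -/
def uniqueSolution [L.IsRelational] {n : ℕ} (φ : L.Formula (Fin (n + 1))) (a : Fin n → ℕ)
    (b : ℕ) : Set (StrL L) :=
  {x | ((∀ i, b ≠ a i) ∧ SatF L x φ (Fin.snoc a b)) ∧
    ∀ c, (∀ i, c ≠ a i) ∧ SatF L x φ (Fin.snoc a c) → c = b}

theorem measurableSet_uniqueSolution [L.IsRelational] {n : ℕ} (φ : L.Formula (Fin (n + 1)))
    (a : Fin n → ℕ) (b : ℕ) : MeasurableSet (uniqueSolution L φ a b) := by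
  have solution : ∀ c, Measurable fun x : StrL L =>
      (∀ i, c ≠ a i) ∧ SatF L x φ (Fin.snoc a c) := fun c =>
    measurable_const.and (measurableSet_extF L φ _).mem
  exact ((solution b).and (Measurable.forall fun c => (solution c).imp measurable_const)).setOf

theorem image_act_uniqueSolution_subset [L.IsRelational] {n : ℕ} (φ : L.Formula (Fin (n + 1)))
    (a : Fin n → ℕ) (b : ℕ) (σ : Equiv.Perm ℕ) (hσ : ∀ i, σ (a i) = a i) :
    act L σ '' uniqueSolution L φ a b ⊆ uniqueSolution L φ a (σ b) := by
  have key : ∀ (x : StrL L) (c : ℕ),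
      ((∀ i, σ c ≠ a i) ∧ SatF L (act L σ x) φ (Fin.snoc a (σ c))) ↔
        ((∀ i, c ≠ a i) ∧ SatF L x φ (Fin.snoc a c)) := by
    intro x c
    refine and_congr (forall_congr' fun i => ?_) ?_
    · rw [← hσ i, σ.injective.ne_iff, hσ i]
    · rw [← satF_act L σ x, Fin.comp_snoc, show σ ∘ a = a from funext hσ]
  rintro _ ⟨x, ⟨hb, huniq⟩, rfl⟩
  refine ⟨(key x b).2 hb, fun c hc => ?_⟩
  obtain ⟨d, rfl⟩ := σ.surjective c
  rw [huniq d ((key x d).1 hc)]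

theorem measure_uniqueSolution [L.IsRelational] {μ : Measure (StrL L)} [IsFiniteMeasure μ]
    (hμ : Invariant L μ) {n : ℕ} (φ : L.Formula (Fin (n + 1))) (a : Fin n → ℕ) (b : ℕ) :
    μ (uniqueSolution L φ a b) = 0 := by
  by_contra hpos
  have hb : ∀ i, b ≠ a i := by
    obtain ⟨x, hx⟩ := nonempty_of_measure_ne_zero hpos
    exact hx.1.1
  have hfin := Measure.finite_const_le_meas_of_disjoint_iUnion μ (pos_iff_ne_zero.2 hpos)
    (measurableSet_uniqueSolution L φ a)
    (fun c d hcd => Set.disjoint_left.2 fun x hc hd => hcd (hd.2 c hc.1)) (measure_ne_top μ _)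
  refine (Set.finite_range a).infinite_compl (hfin.subset fun c hc => ?_)
  have hc' : ∀ i, c ≠ a i := fun i h => hc ⟨i, h.symm⟩
  have hsub := image_act_uniqueSolution_subset L φ a b (Equiv.swap b c)
    fun i => Equiv.swap_apply_of_ne_of_ne (hb i).symm (hc' i).symm
  rw [Equiv.swap_apply_left] at hsub
  exact (hμ _ _ (measurableSet_uniqueSolution L φ a b)).symm.trans_le (measure_mono hsub)

/-- Trivial definable closure of the almost-sure theory: for an ergodic structure μ, there is
no first-order formula φ(x̄, y) such that the sentence `∃x̄ ∃!y ((⋀ᵢ y ≠ xᵢ) ∧ φ(x̄, y))` holds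
almost surely. -/
theorem statement2 [L.IsRelational] [∀ n, Countable (L.Relations n)]
    (μ : Measure (StrL L)) (hμ : IsErgodicStructure L μ) :
    ¬ ∃ (n : ℕ) (φ : L.Formula (Fin (n + 1))),
      μ {x : StrL L | ∃ a : Fin n → ℕ, ∃! b : ℕ,
        (∀ i, b ≠ a i) ∧ SatF L x φ (Fin.snoc a b)} = 1 := by
  rintro ⟨n, φ, h⟩
  have := hμ.1
  have hnull : μ (⋃ (a : Fin n → ℕ) (b : ℕ), uniqueSolution L φ a b) = 0 :=
    measure_iUnion_null fun a => measure_iUnion_null (measure_uniqueSolution L hμ.2.1 φ a)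
  refine one_ne_zero (h.symm.trans (measure_mono_null ?_ hnull))
  rintro x ⟨a, b, hb⟩
  exact mem_iUnion₂.2 ⟨a, b, hb⟩

end Ergo
end

section
/- With the refining chain (𝒫_α)_{α<ω₁} as in the context, there exists a countable ordinal γ < ω₁ such that no member of 𝒫_γ splits later, i.e., for every A ∈ 𝒫_γ and every β with γ < β < ω₁ there is some B ∈ 𝒫_β with B ⊆ A and μ(B) = μ(A). -/
open MeasureTheory Set

/-- The first uncountable ordinal `ω₁`. -/
noncomputable def omega1 : Ordinal.{0} := (Cardinal.aleph 1).ord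

open scoped ENNReal

/-- Pairwise disjoint measurable subsets `B i` of `A` satisfy `∑ μ A * μ (B i) ≤ μ A ^ 2`. -/
theorem tsum_measure_mul_le {Ω ι : Type*} [MeasurableSpace Ω] {μ : Measure Ω}
    {A : Set Ω} {B : ι → Set Ω} (hmeas : ∀ i, MeasurableSet (B i))
    (hdisj : Pairwise (Function.onFun Disjoint B)) (hsub : ∀ i, B i ⊆ A) :
    ∑' i, μ A * μ (B i) ≤ μ A ^ 2 := by
  rw [ENNReal.tsum_mul_left, sq]
  gcongr
  exact (tsum_meas_le_meas_iUnion_of_disjoint μ hmeas hdisj).trans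
    (measure_mono (iUnion_subset hsub))

theorem measure_sq_le_mul {Ω : Type*} [MeasurableSpace Ω] (μ : Measure Ω) {A B : Set Ω}
    (h : B ⊆ A) : μ B ^ 2 ≤ μ A * μ B := by
  rw [sq]
  gcongr

/-- Pairwise disjoint measurable subsets `B i` of `A` satisfy `∑ μ (B i) ^ 2 ≤ μ A ^ 2`. -/
theorem tsum_measure_sq_le {Ω ι : Type*} [MeasurableSpace Ω] {μ : Measure Ω}
    {A : Set Ω} {B : ι → Set Ω} (hmeas : ∀ i, MeasurableSet (B i))
    (hdisj : Pairwise (Function.onFun Disjoint B)) (hsub : ∀ i, B i ⊆ A) :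
    ∑' i, μ (B i) ^ 2 ≤ μ A ^ 2 :=
  (ENNReal.tsum_le_tsum fun i ↦ measure_sq_le_mul μ (hsub i)).trans
    (tsum_measure_mul_le hmeas hdisj hsub)

/-- If pairwise disjoint measurable subsets `B i` of a set `A` of positive measure have positive
measure strictly below `μ A`, then `∑ μ (B i) ^ 2 < μ A ^ 2`. -/
theorem tsum_measure_sq_lt {Ω ι : Type*} [MeasurableSpace Ω] {μ : Measure Ω} [IsFiniteMeasure μ]
    {A : Set Ω} (hA : 0 < μ A) {B : ι → Set Ω} (hmeas : ∀ i, MeasurableSet (B i))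
    (hpos : ∀ i, 0 < μ (B i)) (hdisj : Pairwise (Function.onFun Disjoint B))
    (hsub : ∀ i, B i ⊆ A) (hlt : ∀ i, μ (B i) < μ A) :
    ∑' i, μ (B i) ^ 2 < μ A ^ 2 := by
  rcases isEmpty_or_nonempty ι with h | ⟨⟨i⟩⟩
  · rw [tsum_empty]
    exact pos_iff_ne_zero.2 (pow_ne_zero 2 hA.ne')
  · refine lt_of_lt_of_le (ENNReal.tsum_lt_tsum (i := i) ?_
      (fun j ↦ measure_sq_le_mul μ (hsub j)) ?_) (tsum_measure_mul_le hmeas hdisj hsub)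
    · exact ne_top_of_le_ne_top (ENNReal.pow_ne_top (measure_ne_top μ A))
        (tsum_measure_sq_le hmeas hdisj hsub)
    · rw [sq]
      exact (ENNReal.mul_lt_mul_iff_left (hpos i).ne' (measure_ne_top μ _)).2 (hlt i)

/-- An antitone function from the countable ordinals to `ℝ≥0∞` attains its minimum. -/
theorem exists_lt_omega1_forall_le {f : Ordinal.{0} → ℝ≥0∞}
    (hf : ∀ α β, α ≤ β → β < omega1 → f β ≤ f α) :
    ∃ γ < omega1, ∀ β < omega1, f γ ≤ f β := by
  have h0 : (0 : Ordinal.{0}) < omega1 := by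
    rw [omega1, Cardinal.ord_aleph]
    exact Ordinal.omega_pos 1
  obtain ⟨u, -, hu, hmem⟩ := exists_seq_tendsto_sInf (S := f '' Iio omega1) ⟨f 0, 0, h0, rfl⟩
    (OrderBot.bddBelow _)
  choose a ha hau using hmem
  have hsup : ⨆ n, a n < omega1 := by
    have h := Ordinal.iSup_lt_omega_one (f := a)
    rw [← Cardinal.ord_aleph] at h
    exact h ha
  refine ⟨⨆ n, a n, hsup, fun β hβ ↦ le_trans ?_ (sInf_le (mem_image_of_mem f hβ))⟩
  refine ge_of_tendsto' hu fun n ↦ ?_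
  rw [← hau n]
  exact hf _ _ (Ordinal.le_iSup a n) hsup

/-- Stabilization: given a refining chain `(𝒫_α)_{α<ω₁}` of pairwise disjoint families of
positive-measure measurable sets in a probability space, there is a countable ordinal `γ`
such that no member of `𝒫_γ` splits later: for every `A ∈ 𝒫_γ` and every `β` with
`γ < β < ω₁` there is `B ∈ 𝒫_β` with `B ⊆ A` and `μ B = μ A`. -/
theorem statement5 {Ω : Type*} [MeasurableSpace Ω] (μ : Measure Ω) [IsProbabilityMeasure μ]
    (P : Ordinal → Set (Set Ω))
    (hmeas : ∀ α < omega1, ∀ A ∈ P α, MeasurableSet A)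
    (hpos : ∀ α < omega1, ∀ A ∈ P α, 0 < μ A)
    (hdisj : ∀ α < omega1, (P α).PairwiseDisjoint id)
    (hrefine : ∀ α β : Ordinal, α < β → β < omega1 → ∀ B ∈ P β, ∃ A ∈ P α, B ⊆ A) :
    ∃ γ, γ < omega1 ∧ ∀ A ∈ P γ, ∀ β, γ < β → β < omega1 →
      ∃ B ∈ P β, B ⊆ A ∧ μ B = μ A := by
  have hfiber : ∀ α β, α < β → β < omega1 → ∃ p : P β → P α, (∀ B : P β, (B : Set Ω) ⊆ p B) ∧
      ∑' B : P β, μ B ^ 2 = ∑' A : P α, ∑' B : {B // p B = A}, μ (B : P β) ^ 2 := by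
    intro α β hαβ hβ
    have h : ∀ B : P β, ∃ A : P α, (B : Set Ω) ⊆ A := fun B ↦ by
      obtain ⟨A, hA, hBA⟩ := hrefine α β hαβ hβ B B.2
      exact ⟨⟨A, hA⟩, hBA⟩
    choose p hp using h
    refine ⟨p, hp, ?_⟩
    rw [← (Equiv.sigmaFiberEquiv p).tsum_eq, ENNReal.tsum_sigma']
    rfl
  have hdisj' : ∀ β < omega1, Pairwise (Function.onFun Disjoint fun B : P β ↦ (B : Set Ω)) :=
    fun β hβ B C hBC ↦ hdisj β hβ B.2 C.2 (Subtype.coe_injective.ne hBC)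
  have hle : ∀ α β, ∀ hβ : β < omega1, ∀ p : P β → P α, (∀ B : P β, (B : Set Ω) ⊆ p B) → ∀ A : P α,
      ∑' B : {B // p B = A}, μ (B : P β) ^ 2 ≤ μ A ^ 2 := fun α β hβ p hp A ↦
    tsum_measure_sq_le (fun B ↦ hmeas β hβ _ B.1.2)
      (fun B C hBC ↦ hdisj' β hβ (Subtype.coe_injective.ne hBC))
      (fun B ↦ (hp B.1).trans_eq (congrArg _ B.2))
  obtain ⟨γ, hγ, hmin⟩ := exists_lt_omega1_forall_le (f := fun α ↦ ∑' A : P α, μ A ^ 2) (by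
    intro α β hαβ hβ
    rcases hαβ.eq_or_lt with rfl | hlt
    · exact le_rfl
    · obtain ⟨p, hp, hsum⟩ := hfiber α β hlt hβ
      exact hsum.trans_le (ENNReal.tsum_le_tsum (hle α β hβ p hp)))
  refine ⟨γ, hγ, fun A hA β hγβ hβ ↦ ?_⟩
  by_contra! hsplit
  obtain ⟨p, hp, hsum⟩ := hfiber γ β hγβ hβ
  refine (hmin β hβ).not_gt (hsum.trans_lt ?_)
  have hfin : ∑' A : P γ, μ A ^ 2 ≠ ∞ :=
    ne_top_of_le_ne_top (ENNReal.pow_ne_top (measure_ne_top μ univ))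
      (tsum_measure_sq_le (fun A ↦ hmeas γ hγ _ A.2) (hdisj' γ hγ) fun _ ↦ subset_univ _)
  refine ENNReal.tsum_lt_tsum (i := ⟨A, hA⟩) ?_ (hle γ β hβ p hp) ?_
  · exact ne_top_of_le_ne_top hfin (ENNReal.tsum_le_tsum (hle γ β hβ p hp))
  · have hsub : ∀ B : {B // p B = ⟨A, hA⟩}, ((B : P β) : Set Ω) ⊆ A := fun B ↦
      (hp B.1).trans_eq (congrArg _ B.2)
    exact tsum_measure_sq_lt (hpos γ hγ A hA) (fun B ↦ hmeas β hβ _ B.1.2)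
      (fun B ↦ hpos β hβ _ B.1.2) (fun B C hBC ↦ hdisj' β hβ (Subtype.coe_injective.ne hBC)) hsub
      (fun B ↦ (measure_mono (hsub B)).lt_of_ne (hsplit _ B.1.2 (hsub B)))
end
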